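/- arXiv:2209.09514 — 3 statements merged into one kernel-verified Lean document; each statement's English description precedes it below -/
import Mathlib

section
/- For any Lie superalgebra M over a field of characteristic ≠ 2, 3, there exists an exact sequence Γ(M^{ab}) →ψ M ⊗ M →π M ∧ M → 0, where π is the canonical projection. Moreover, for any two graded ideals I and J of M, the sequence Γ((I ∩ J)/[I, J]) →ψ I ⊗ J →π I ∧ J → 0 is exact. -/
open Module Function TensorProduct

universe u v w x y z

/-- The sign `(-1)^(ab)` for degrees `a b : ZMod 2`, as an element of the field `F`. -/
def sgn (F : Type u) [Field F] (a b : ZMod 2) : F :=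
  if a = 1 ∧ b = 1 then -1 else 1

/-- A supermodule (ℤ/2-graded vector space) over `F`. -/
class SuperModule (F : Type u) (V : Type v) [Field F] [AddCommGroup V] [Module F V] where
  grade : ZMod 2 → Submodule F V
  isCompl_grade : IsCompl (grade 0) (grade 1)

/-- The graded piece of degree `a`. -/
abbrev gr (F : Type u) (V : Type v) [Field F] [AddCommGroup V] [Module F V]
    [s : SuperModule F V] (a : ZMod 2) : Submodule F V := s.grade a

/-- A Lie superalgebra structure on a supermodule. -/
class LieSuperAlgebra (F : Type u) (L : Type v) [Field F] [AddCommGroup L] [Module F L]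
    [SuperModule F L] where
  bracket : L →ₗ[F] L →ₗ[F] L
  bracket_grade : ∀ (a b : ZMod 2) (x y : L), x ∈ gr F L a → y ∈ gr F L b →
    bracket x y ∈ gr F L (a + b)
  skew : ∀ (a b : ZMod 2) (x y : L), x ∈ gr F L a → y ∈ gr F L b →
    bracket x y = -(sgn F a b) • bracket y x
  jacobi : ∀ (a b c : ZMod 2) (x y zz : L), x ∈ gr F L a → y ∈ gr F L b → zz ∈ gr F L c →
    sgn F a c • bracket x (bracket y zz) + sgn F b a • bracket y (bracket zz x)
      + sgn F c b • bracket zz (bracket x y) = 0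

/-- The bracket of a Lie superalgebra. -/
abbrev br (F : Type u) (L : Type v) [Field F] [AddCommGroup L] [Module F L] [SuperModule F L]
    [s : LieSuperAlgebra F L] : L →ₗ[F] L →ₗ[F] L := s.bracket

/-- A graded submodule. -/
def IsGradedSub (F : Type u) {V : Type v} [Field F] [AddCommGroup V] [Module F V]
    [SuperModule F V] (N : Submodule F V) : Prop :=
  N ≤ (N ⊓ gr F V 0) ⊔ (N ⊓ gr F V 1)

section LSADefs

variable (F : Type u) [Field F]
variable (L : Type v) [AddCommGroup L] [Module F L] [SuperModule F L] [LieSuperAlgebra F L]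

/-- The derived subalgebra `L² = [L, L]`. -/
def derivedSub : Submodule F L := Submodule.span F {t | ∃ x y : L, br F L x y = t}

/-- The center `Z(L)`. -/
def centerSub : Submodule F L := ⨅ x : L, LinearMap.ker ((br F L).flip x)

/-- The span of brackets `[A, B]` of two submodules. -/
def bracketSub (A B : Submodule F L) : Submodule F L :=
  Submodule.span F {t | ∃ x ∈ A, ∃ y ∈ B, br F L x y = t}

/-- Abelian Lie superalgebra. -/
def IsAbelianLSA : Prop := ∀ x y : L, br F L x y = 0

/-- The lower central series. -/
def lcs : ℕ → Submodule F L
  | 0 => ⊤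
  | n + 1 => Submodule.span F {t | ∃ x : L, ∃ y ∈ lcs n, br F L x y = t}

/-- Nilpotent Lie superalgebra. -/
def IsNilpotentLSA : Prop := ∃ n : ℕ, lcs F L n = ⊥

end LSADefs

/-- Homomorphism of Lie superalgebras: an even linear map preserving grading and bracket. -/
structure LieSuperHom (F : Type u) (L : Type v) (M : Type w) [Field F]
    [AddCommGroup L] [Module F L] [SuperModule F L] [LieSuperAlgebra F L]
    [AddCommGroup M] [Module F M] [SuperModule F M] [LieSuperAlgebra F M]
    extends L →ₗ[F] M where
  map_grade : ∀ (a : ZMod 2) (x : L), x ∈ gr F L a → toLinearMap x ∈ gr F M a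
  map_bracket : ∀ x y : L, toLinearMap (br F L x y) = br F M (toLinearMap x) (toLinearMap y)

/-- Isomorphism of Lie superalgebras. -/
def LSAIsomorphic (F : Type u) (L : Type v) (M : Type w) [Field F]
    [AddCommGroup L] [Module F L] [SuperModule F L] [LieSuperAlgebra F L]
    [AddCommGroup M] [Module F M] [SuperModule F M] [LieSuperAlgebra F M] : Prop :=
  ∃ f : LieSuperHom F L M, Function.Bijective f.toLinearMap

/-- `Q` is (a realization of) the quotient `L / L²`, i.e. the abelianization of `L`. -/
def IsQuotientByDerived (F : Type u) (L : Type v) (Q : Type w) [Field F]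
    [AddCommGroup L] [Module F L] [SuperModule F L] [LieSuperAlgebra F L]
    [AddCommGroup Q] [Module F Q] [SuperModule F Q] [LieSuperAlgebra F Q] : Prop :=
  ∃ f : LieSuperHom F L Q, Function.Surjective f.toLinearMap ∧
    LinearMap.ker f.toLinearMap = derivedSub F L

/-- An action of the Lie superalgebra `P` on the Lie superalgebra `M`. -/
structure LieSuperAction (F : Type u) (P : Type v) (M : Type w) [Field F]
    [AddCommGroup P] [Module F P] [SuperModule F P] [LieSuperAlgebra F P]
    [AddCommGroup M] [Module F M] [SuperModule F M] [LieSuperAlgebra F M] where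
  act : P →ₗ[F] M →ₗ[F] M
  act_grade : ∀ (a b : ZMod 2) (p : P) (m : M), p ∈ gr F P a → m ∈ gr F M b →
    act p m ∈ gr F M (a + b)
  act_bracket : ∀ (a b : ZMod 2) (p p' : P) (m : M), p ∈ gr F P a → p' ∈ gr F P b →
    act (br F P p p') m = act p (act p' m) - sgn F a b • act p' (act p m)
  act_lie : ∀ (a b : ZMod 2) (p : P) (m m' : M), p ∈ gr F P a → m ∈ gr F M b →
    act p (br F M m m') = br F M (act p m) m' + sgn F a b • br F M m (act p m')

/-- A trivial action. -/
def LieSuperAction.IsTrivial {F : Type u} {P : Type v} {M : Type w} [Field F]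
    [AddCommGroup P] [Module F P] [SuperModule F P] [LieSuperAlgebra F P]
    [AddCommGroup M] [Module F M] [SuperModule F M] [LieSuperAlgebra F M]
    (α : LieSuperAction F P M) : Prop := ∀ (p : P) (m : M), α.act p m = 0

/-- The trivial action of `P` on `M`. -/
def trivialAction (F : Type u) (P : Type v) (M : Type w) [Field F]
    [AddCommGroup P] [Module F P] [SuperModule F P] [LieSuperAlgebra F P]
    [AddCommGroup M] [Module F M] [SuperModule F M] [LieSuperAlgebra F M] :
    LieSuperAction F P M where
  act := 0
  act_grade := by
    intro a b p m _ _
    simp only [LinearMap.zero_apply]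
    exact (gr F M (a + b)).zero_mem
  act_bracket := by intro a b p p' m _ _; simp
  act_lie := by intro a b p m m' _ _; simp

/-- A Lie superpairing on `M × N` (relative to mutual actions) with values in the
Lie superalgebra `T`; these are exactly the defining relations of the non-abelian
tensor product `M ⊗ N`. -/
structure SuperPairing (F : Type u) (M : Type v) (N : Type w) (T : Type x) [Field F]
    [AddCommGroup M] [Module F M] [SuperModule F M] [LieSuperAlgebra F M]
    [AddCommGroup N] [Module F N] [SuperModule F N] [LieSuperAlgebra F N]
    [AddCommGroup T] [Module F T] [SuperModule F T] [LieSuperAlgebra F T]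
    (α : LieSuperAction F M N) (β : LieSuperAction F N M) where
  pair : M →ₗ[F] N →ₗ[F] T
  pair_grade : ∀ (a b : ZMod 2) (m : M) (n : N), m ∈ gr F M a → n ∈ gr F N b →
    pair m n ∈ gr F T (a + b)
  rel1 : ∀ (a b : ZMod 2) (m m' : M) (n : N), m ∈ gr F M a → m' ∈ gr F M b →
    pair (br F M m m') n = pair m (α.act m' n) - sgn F a b • pair m' (α.act m n)
  rel2 : ∀ (a b c : ZMod 2) (m : M) (n n' : N), m ∈ gr F M a → n ∈ gr F N b → n' ∈ gr F N c →
    pair m (br F N n n') = sgn F c (a + b) • pair (β.act n' m) n - sgn F a b • pair (β.act n m) n'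
  rel3 : ∀ (a b : ZMod 2) (m : M) (n : N) (m' : M) (n' : N), m ∈ gr F M a → n ∈ gr F N b →
    br F T (pair m n) (pair m' n') = - sgn F a b • pair (β.act n m) (α.act m' n')

/-- `T`, together with the pairing `p`, is (a realization of) the non-abelian tensor
product `M ⊗ N`: it satisfies the universal property among Lie superpairings. -/
def IsTensorProductLSA (F : Type u) (M : Type v) (N : Type w) (T : Type x) [Field F]
    [AddCommGroup M] [Module F M] [SuperModule F M] [LieSuperAlgebra F M]
    [AddCommGroup N] [Module F N] [SuperModule F N] [LieSuperAlgebra F N]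
    [AddCommGroup T] [Module F T] [SuperModule F T] [LieSuperAlgebra F T]
    (α : LieSuperAction F M N) (β : LieSuperAction F N M)
    (p : SuperPairing F M N T α β) : Prop :=
  ∀ (T' : Type (max u v w x)) [AddCommGroup T'] [Module F T'] [SuperModule F T']
    [LieSuperAlgebra F T'] (q : SuperPairing F M N T' α β),
    ∃! h : LieSuperHom F T T', ∀ (m : M) (n : N), h.toLinearMap (p.pair m n) = q.pair m n

/-- A Lie superpairing for the tensor square `L ⊗ L` (with adjoint actions):
the defining relations of the non-abelian tensor square. -/
structure TensorSqPairing (F : Type u) (L : Type v) (T : Type w) [Field F]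
    [AddCommGroup L] [Module F L] [SuperModule F L] [LieSuperAlgebra F L]
    [AddCommGroup T] [Module F T] [SuperModule F T] [LieSuperAlgebra F T] where
  pair : L →ₗ[F] L →ₗ[F] T
  pair_grade : ∀ (a b : ZMod 2) (x y : L), x ∈ gr F L a → y ∈ gr F L b →
    pair x y ∈ gr F T (a + b)
  rel1 : ∀ (a b : ZMod 2) (x x' y : L), x ∈ gr F L a → x' ∈ gr F L b →
    pair (br F L x x') y = pair x (br F L x' y) - sgn F a b • pair x' (br F L x y)
  rel2 : ∀ (a b c : ZMod 2) (x y y' : L), x ∈ gr F L a → y ∈ gr F L b → y' ∈ gr F L c →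
    pair x (br F L y y') = sgn F c (a + b) • pair (br F L y' x) y
      - sgn F a b • pair (br F L y x) y'
  rel3 : ∀ (a b : ZMod 2) (x y x' y' : L), x ∈ gr F L a → y ∈ gr F L b →
    br F T (pair x y) (pair x' y') = - sgn F a b • pair (br F L y x) (br F L x' y')

/-- `T`, together with the pairing `p`, is (a realization of) the non-abelian tensor
square `L ⊗ L`. -/
def IsTensorSquare (F : Type u) (L : Type v) (T : Type w) [Field F]
    [AddCommGroup L] [Module F L] [SuperModule F L] [LieSuperAlgebra F L]
    [AddCommGroup T] [Module F T] [SuperModule F T] [LieSuperAlgebra F T]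
    (p : TensorSqPairing F L T) : Prop :=
  ∀ (T' : Type (max u v w)) [AddCommGroup T'] [Module F T'] [SuperModule F T']
    [LieSuperAlgebra F T'] (q : TensorSqPairing F L T'),
    ∃! h : LieSuperHom F T T', ∀ x y : L, h.toLinearMap (p.pair x y) = q.pair x y

/-- The submodule `L □ L` of a realization `T` of `L ⊗ L`, generated by the elements
`x ⊗ x' + (-1)^{|x||x'|} (x' ⊗ x)` (homogeneous `x, x'`) and `x₀ ⊗ x₀` (`x₀` even). -/
def squareBox (F : Type u) (L : Type v) (T : Type w) [Field F]
    [AddCommGroup L] [Module F L] [SuperModule F L] [LieSuperAlgebra F L]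
    [AddCommGroup T] [Module F T] [SuperModule F T] [LieSuperAlgebra F T]
    (p : TensorSqPairing F L T) : Submodule F T :=
  Submodule.span F
    ({t | ∃ (a b : ZMod 2) (x y : L), x ∈ gr F L a ∧ y ∈ gr F L b ∧
        t = p.pair x y + sgn F a b • p.pair y x} ∪
      {t | ∃ x ∈ gr F L 0, t = p.pair x x})

/-- Data of a "universal quadratic functor" target: maps satisfying the defining
relations of `Γ(V)`. -/
structure GammaData (F : Type u) (V : Type v) (W : Type w) [Field F]
    [AddCommGroup V] [Module F V] [SuperModule F V] [AddCommGroup W] [Module F W] where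
  gam : V → W
  bil : V →ₗ[F] V →ₗ[F] W
  gam_smul : ∀ (c : F) (v : V), v ∈ gr F V 0 → gam (c • v) = (c * c) • gam v
  gam_add : ∀ v w' : V, v ∈ gr F V 0 → w' ∈ gr F V 0 →
    gam (v + w') - gam v - gam w' = bil v w'
  bil_symm : ∀ (a b : ZMod 2) (v w' : V), v ∈ gr F V a → w' ∈ gr F V b →
    bil v w' = sgn F a b • bil w' v
  bil_alt : ∀ v : V, v ∈ gr F V 1 → bil v v = 0

/-- `W`, with data `d`, is (a realization of) the universal quadratic functor `Γ(V)`. -/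
def IsGamma (F : Type u) (V : Type v) (W : Type w) [Field F]
    [AddCommGroup V] [Module F V] [SuperModule F V] [AddCommGroup W] [Module F W]
    (d : GammaData F V W) : Prop :=
  ∀ (W' : Type (max u v w)) [AddCommGroup W'] [Module F W'] (d' : GammaData F V W'),
    ∃! h : W →ₗ[F] W',
      (∀ v ∈ gr F V 0, h (d.gam v) = d'.gam v) ∧ (∀ v w' : V, h (d.bil v w') = d'.bil v w')

/-- `Fr` is a free Lie superalgebra on the graded set `(X, deg)` with inclusion `ι`. -/
def IsFreeLSA (F : Type u) (X : Type v) (deg : X → ZMod 2) (Fr : Type w) [Field F]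
    [AddCommGroup Fr] [Module F Fr] [SuperModule F Fr] [LieSuperAlgebra F Fr]
    (ι : X → Fr) : Prop :=
  (∀ x : X, ι x ∈ gr F Fr (deg x)) ∧
  ∀ (K : Type (max u v w)) [AddCommGroup K] [Module F K] [SuperModule F K]
    [LieSuperAlgebra F K] (f : X → K), (∀ x : X, f x ∈ gr F K (deg x)) →
    ∃! h : LieSuperHom F Fr K, ∀ x : X, h.toLinearMap (ι x) = f x

/-- Dimension of the degree-`a` part of the Schur multiplier `(R ∩ [Fr,Fr])/[Fr,R]`
attached to a free presentation with kernel `R`. -/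
noncomputable def schurDim (F : Type u) (Fr : Type v) [Field F] [AddCommGroup Fr]
    [Module F Fr] [SuperModule F Fr] [LieSuperAlgebra F Fr]
    (R : Submodule F Fr) (a : ZMod 2) : ℕ :=
  finrank F ((R ⊓ derivedSub F Fr ⊓ gr F Fr a).map (bracketSub F Fr ⊤ R).mkQ)

/-- `L` is (isomorphic to) the Heisenberg Lie superalgebra `H(m, n)` with even center:
it admits a homogeneous basis `x₁,…,x_{2m}, y₁,…,y_n, z` with the defining brackets. -/
def IsHmn (F : Type u) (m n : ℕ) (L : Type v) [Field F]
    [AddCommGroup L] [Module F L] [SuperModule F L] [LieSuperAlgebra F L] : Prop :=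
  ∃ (xv : Fin (2 * m) → L) (yv : Fin n → L) (zv : L)
    (B : Basis ((Fin (2 * m)) ⊕ (Fin n) ⊕ Unit) F L),
    (∀ i, B (Sum.inl i) = xv i) ∧ (∀ j, B (Sum.inr (Sum.inl j)) = yv j) ∧
    B (Sum.inr (Sum.inr ())) = zv ∧
    (∀ i, xv i ∈ gr F L 0) ∧ (∀ j, yv j ∈ gr F L 1) ∧ zv ∈ gr F L 0 ∧
    (∀ i j : Fin (2 * m), br F L (xv i) (xv j) =
      if (j : ℕ) = (i : ℕ) + m then zv else if (i : ℕ) = (j : ℕ) + m then -zv else 0) ∧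
    (∀ (i : Fin (2 * m)) (j : Fin n), br F L (xv i) (yv j) = 0) ∧
    (∀ (j : Fin n) (i : Fin (2 * m)), br F L (yv j) (xv i) = 0) ∧
    (∀ j k : Fin n, br F L (yv j) (yv k) = if j = k then zv else 0) ∧
    (∀ i, br F L (xv i) zv = 0) ∧ (∀ i, br F L zv (xv i) = 0) ∧
    (∀ j, br F L (yv j) zv = 0) ∧ (∀ j, br F L zv (yv j) = 0) ∧
    br F L zv zv = 0

/-- `L` is (isomorphic to) the Heisenberg Lie superalgebra `H_m` with odd center. -/
def IsHmOdd (F : Type u) (m : ℕ) (L : Type v) [Field F]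
    [AddCommGroup L] [Module F L] [SuperModule F L] [LieSuperAlgebra F L] : Prop :=
  ∃ (xv yv : Fin m → L) (zv : L) (B : Basis ((Fin m) ⊕ (Fin m) ⊕ Unit) F L),
    (∀ i, B (Sum.inl i) = xv i) ∧ (∀ j, B (Sum.inr (Sum.inl j)) = yv j) ∧
    B (Sum.inr (Sum.inr ())) = zv ∧
    (∀ i, xv i ∈ gr F L 0) ∧ (∀ j, yv j ∈ gr F L 1) ∧ zv ∈ gr F L 1 ∧
    (∀ i j, br F L (xv i) (xv j) = 0) ∧
    (∀ i j, br F L (xv i) (yv j) = if i = j then zv else 0) ∧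
    (∀ i j, br F L (yv i) (xv j) = if i = j then -zv else 0) ∧
    (∀ i j, br F L (yv i) (yv j) = 0) ∧
    (∀ i, br F L (xv i) zv = 0) ∧ (∀ i, br F L zv (xv i) = 0) ∧
    (∀ j, br F L (yv j) zv = 0) ∧ (∀ j, br F L zv (yv j) = 0) ∧
    br F L zv zv = 0

/-- `A` is (isomorphic to) the abelian Lie superalgebra `A(a | b)`. -/
def IsAbelianOfDim (F : Type u) (a b : ℕ) (A : Type v) [Field F]
    [AddCommGroup A] [Module F A] [SuperModule F A] [LieSuperAlgebra F A] : Prop :=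
  IsAbelianLSA F A ∧ finrank F (gr F A 0) = a ∧ finrank F (gr F A 1) = b

/-- Heisenberg Lie superalgebra with even center: `Z(L) = L²` is one-dimensional,
spanned by a nonzero even element. -/
def IsHeisenbergEven (F : Type u) (L : Type v) [Field F]
    [AddCommGroup L] [Module F L] [SuperModule F L] [LieSuperAlgebra F L] : Prop :=
  centerSub F L = derivedSub F L ∧
  ∃ zc : L, zc ≠ 0 ∧ zc ∈ gr F L 0 ∧ centerSub F L = Submodule.span F {zc}

/-- Heisenberg Lie superalgebra with odd center. -/
def IsHeisenbergOdd (F : Type u) (L : Type v) [Field F]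
    [AddCommGroup L] [Module F L] [SuperModule F L] [LieSuperAlgebra F L] : Prop :=
  centerSub F L = derivedSub F L ∧
  ∃ zc : L, zc ≠ 0 ∧ zc ∈ gr F L 1 ∧ centerSub F L = Submodule.span F {zc}

/-- `P ≅ L ⊕ M` as Lie superalgebras (internal direct sum of two commuting copies). -/
def IsDirectSumOf (F : Type u) (P : Type v) (L : Type w) (M : Type x) [Field F]
    [AddCommGroup P] [Module F P] [SuperModule F P] [LieSuperAlgebra F P]
    [AddCommGroup L] [Module F L] [SuperModule F L] [LieSuperAlgebra F L]
    [AddCommGroup M] [Module F M] [SuperModule F M] [LieSuperAlgebra F M] : Prop :=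
  ∃ (f : LieSuperHom F L P) (g : LieSuperHom F M P),
    Function.Bijective (fun q : L × M => f.toLinearMap q.1 + g.toLinearMap q.2) ∧
    (∀ (x : L) (y : M), br F P (f.toLinearMap x) (g.toLinearMap y) = 0) ∧
    (∀ (y : M) (x : L), br F P (g.toLinearMap y) (f.toLinearMap x) = 0)

/-- `S ≅ A ⊕ B ⊕ C ⊕ D` as Lie superalgebras. -/
def IsDirectSumOf4 (F : Type u) (S : Type v) (A : Type w) (B : Type x) (C : Type y)
    (D : Type z) [Field F]
    [AddCommGroup S] [Module F S] [SuperModule F S] [LieSuperAlgebra F S]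
    [AddCommGroup A] [Module F A] [SuperModule F A] [LieSuperAlgebra F A]
    [AddCommGroup B] [Module F B] [SuperModule F B] [LieSuperAlgebra F B]
    [AddCommGroup C] [Module F C] [SuperModule F C] [LieSuperAlgebra F C]
    [AddCommGroup D] [Module F D] [SuperModule F D] [LieSuperAlgebra F D] : Prop :=
  ∃ (f : LieSuperHom F A S) (g : LieSuperHom F B S) (h : LieSuperHom F C S)
    (k : LieSuperHom F D S),
    Function.Bijective (fun q : A × B × C × D =>
      f.toLinearMap q.1 + g.toLinearMap q.2.1 + h.toLinearMap q.2.2.1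
        + k.toLinearMap q.2.2.2) ∧
    (∀ u v', br F S (f.toLinearMap u) (g.toLinearMap v') = 0) ∧
    (∀ u v', br F S (f.toLinearMap u) (h.toLinearMap v') = 0) ∧
    (∀ u v', br F S (f.toLinearMap u) (k.toLinearMap v') = 0) ∧
    (∀ u v', br F S (g.toLinearMap u) (h.toLinearMap v') = 0) ∧
    (∀ u v', br F S (g.toLinearMap u) (k.toLinearMap v') = 0) ∧
    (∀ u v', br F S (h.toLinearMap u) (k.toLinearMap v') = 0)

/-- `L ≅ H(m, n) ⊕ A(a | b)`: an internal decomposition into a Heisenberg part with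
even center, spanned by homogeneous elements with the defining brackets, and a central
abelian graded complement of dimension `(a | b)`. -/
def DecompHeisenbergAbelian (F : Type u) (L : Type v) [Field F]
    [AddCommGroup L] [Module F L] [SuperModule F L] [LieSuperAlgebra F L]
    (m n a b : ℕ) : Prop :=
  ∃ (xv : Fin (2 * m) → L) (yv : Fin n → L) (zv : L) (A : Submodule F L),
    (∀ i, xv i ∈ gr F L 0) ∧ (∀ j, yv j ∈ gr F L 1) ∧ zv ∈ gr F L 0 ∧
    IsGradedSub F A ∧
    finrank F (A ⊓ gr F L 0 : Submodule F L) = a ∧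
    finrank F (A ⊓ gr F L 1 : Submodule F L) = b ∧
    (∀ u ∈ A, ∀ v : L, br F L u v = 0 ∧ br F L v u = 0) ∧
    LinearIndependent F (Sum.elim xv (Sum.elim yv (fun _ : Unit => zv))) ∧
    Disjoint (Submodule.span F (Set.range (Sum.elim xv (Sum.elim yv (fun _ : Unit => zv))))) A ∧
    Submodule.span F (Set.range (Sum.elim xv (Sum.elim yv (fun _ : Unit => zv)))) ⊔ A = ⊤ ∧
    (∀ i j : Fin (2 * m), br F L (xv i) (xv j) =
      if (j : ℕ) = (i : ℕ) + m then zv else if (i : ℕ) = (j : ℕ) + m then -zv else 0) ∧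
    (∀ (i : Fin (2 * m)) (j : Fin n), br F L (xv i) (yv j) = 0) ∧
    (∀ (j : Fin n) (i : Fin (2 * m)), br F L (yv j) (xv i) = 0) ∧
    (∀ j k : Fin n, br F L (yv j) (yv k) = if j = k then zv else 0) ∧
    (∀ i, br F L (xv i) zv = 0) ∧ (∀ i, br F L zv (xv i) = 0) ∧
    (∀ j, br F L (yv j) zv = 0) ∧ (∀ j, br F L zv (yv j) = 0) ∧
    br F L zv zv = 0

/-- The submodule of a realization of `I ⊗ J` (for graded ideals `I, J` of `M`)
generated by `x ⊗ y + (-1)^(|x||y|) y ⊗ x` and `x₀ ⊗ x₀` for `x, y, x₀ ∈ I ∩ J`,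
`x₀` even. -/
def pairBox (F : Type u) (I : Type v) (J : Type w) (TIJ : Type x) (M : Type y) [Field F]
    [AddCommGroup I] [Module F I] [SuperModule F I] [LieSuperAlgebra F I]
    [AddCommGroup J] [Module F J] [SuperModule F J] [LieSuperAlgebra F J]
    [AddCommGroup TIJ] [Module F TIJ] [SuperModule F TIJ] [LieSuperAlgebra F TIJ]
    [AddCommGroup M] [Module F M] [SuperModule F M] [LieSuperAlgebra F M]
    (ι : LieSuperHom F I M) (κ : LieSuperHom F J M)
    (α : LieSuperAction F I J) (β : LieSuperAction F J I)
    (p : SuperPairing F I J TIJ α β) : Submodule F TIJ :=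
  Submodule.span F
    ({t | ∃ (a b : ZMod 2) (i i' : I) (j j' : J),
        ι.toLinearMap i = κ.toLinearMap j ∧ ι.toLinearMap i' = κ.toLinearMap j' ∧
        ι.toLinearMap i ∈ gr F M a ∧ ι.toLinearMap i' ∈ gr F M b ∧
        t = p.pair i j' + sgn F a b • p.pair i' j} ∪
      {t | ∃ (i : I) (j : J), ι.toLinearMap i = κ.toLinearMap j ∧
        ι.toLinearMap i ∈ gr F M 0 ∧ t = p.pair i j})

section Helpers

theorem h14_sgn_symm (F : Type u) [Field F] (a b : ZMod 2) : sgn F a b = sgn F b a := by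
  simp only [sgn, and_comm]

theorem h14_sgn_sq (F : Type u) [Field F] (a b : ZMod 2) : sgn F a b * sgn F a b = 1 := by
  simp only [sgn]; split_ifs <;> simp

theorem h14_two {P : ZMod 2 → Prop} (h0 : P 0) (h1 : P 1) : ∀ a, P a := by
  intro a; fin_cases a
  · exact h0
  · exact h1

theorem h14_sgn_add (F : Type u) [Field F] (a b c : ZMod 2) :
    sgn F a (b + c) = sgn F a b * sgn F a c := by
  have e1 : (1 : ZMod 2) + 1 = 0 := by decide
  revert c; revert b; revert a
  refine h14_two (h14_two (h14_two ?_ ?_) (h14_two ?_ ?_)) (h14_two (h14_two ?_ ?_) (h14_two ?_ ?_)) <;>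
    simp [sgn, e1]

theorem h14_decomp {F : Type u} [Field F] {N : Type v} [AddCommGroup N] [Module F N]
    {gN : ZMod 2 → Submodule F N} (hc : IsCompl (gN 0) (gN 1)) (x : N) :
    ∃ x0 ∈ gN 0, ∃ x1 ∈ gN 1, x0 + x1 = x := by
  have : x ∈ gN 0 ⊔ gN 1 := by rw [hc.sup_eq_top]; trivial
  exact Submodule.mem_sup.1 this

/-- components of a homogeneous element -/
theorem h14_comp {F : Type u} [Field F] {N : Type v} [AddCommGroup N] [Module F N]
    {gN : ZMod 2 → Submodule F N} (hc : IsCompl (gN 0) (gN 1)) {x0 x1 y0 y1 : N}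
    (hx0 : x0 ∈ gN 0) (hx1 : x1 ∈ gN 1) (hy0 : y0 ∈ gN 0) (hy1 : y1 ∈ gN 1)
    (h : x0 + x1 = y0 + y1) : x0 = y0 ∧ x1 = y1 := by
  have e : x0 - y0 = y1 - x1 := by
    rw [sub_eq_sub_iff_add_eq_add, h, add_comm]
  have h1 : x0 - y0 ∈ gN 1 := e ▸ (gN 1).sub_mem hy1 hx1
  have h0 := Submodule.disjoint_def.1 hc.disjoint _ ((gN 0).sub_mem hx0 hy0) h1
  refine ⟨sub_eq_zero.1 h0, ?_⟩
  rw [h0] at e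
  exact (sub_eq_zero.1 e.symm).symm

theorem h14_exists_B {F : Type u} [Field F] {N : Type v} [AddCommGroup N] [Module F N]
    {T : Type w} [AddCommGroup T] [Module F T]
    {gN : ZMod 2 → Submodule F N} (hc : IsCompl (gN 0) (gN 1)) (q : N →ₗ[F] N →ₗ[F] T) :
    ∃ B : N →ₗ[F] N →ₗ[F] T, ∀ (a b : ZMod 2) (x y : N), x ∈ gN a → y ∈ gN b →
      B x y = q x y + sgn F a b • q y x := by
  obtain ⟨P, hP0, hP1⟩ : ∃ P : N →ₗ[F] N, (∀ x ∈ gN 0, P x = 0) ∧ (∀ x ∈ gN 1, P x = x) := by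
    refine ⟨LinearMap.ofIsCompl hc 0 (gN 1).subtype, ?_, ?_⟩
    · intro x hx
      simpa using LinearMap.ofIsCompl_apply_left hc (φ := 0) (ψ := (gN 1).subtype) ⟨x, hx⟩
    · intro x hx
      simpa using LinearMap.ofIsCompl_apply_right hc (φ := 0) (ψ := (gN 1).subtype) ⟨x, hx⟩
  refine ⟨q + q.flip - (2 : F) • (q.compl₁₂ P P).flip, ?_⟩
  intro a b x y
  revert b
  revert a
  refine h14_two (h14_two ?_ ?_) (h14_two ?_ ?_) <;> intro hx hy <;>
    simp [sgn, hP0, hP1, hx, hy, two_smul, sub_eq_add_neg]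

theorem h14_lift {F : Type u} [Field F] {N : Type v} [AddCommGroup N] [Module F N]
    {V : Type w} [AddCommGroup V] [Module F V] [SuperModule F V]
    {gN : ZMod 2 → Submodule F N} (hc : IsCompl (gN 0) (gN 1))
    (θ : N →ₗ[F] V) (hθ : ∀ a x, x ∈ gN a → θ x ∈ gr F V a) (a : ZMod 2) (x : N)
    (hx : θ x ∈ gr F V a) : ∃ x' ∈ gN a, θ x' = θ x := by
  obtain ⟨x0, h0, x1, h1, rfl⟩ := h14_decomp hc x
  revert a
  refine h14_two ?_ ?_
  · intro hx
    refine ⟨x0, h0, ?_⟩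
    refine (h14_comp (SuperModule.isCompl_grade (F := F) (V := V)) (hθ _ _ h0) (hθ _ _ h1) hx
      (Submodule.zero_mem _) ?_).1
    simp
  · intro hx
    refine ⟨x1, h1, ?_⟩
    refine (h14_comp (SuperModule.isCompl_grade (F := F) (V := V)) (hθ _ _ h0) (hθ _ _ h1)
      (Submodule.zero_mem _) hx ?_).2
    simp

/-- Gamma data out of a supersymmetric bilinear map. -/
def h14_data {F : Type u} [Field F] (h2 : (2 : F) ≠ 0)
    {V : Type v} [AddCommGroup V] [Module F V] [SuperModule F V]
    {W : Type w} [AddCommGroup W] [Module F W] (b : V →ₗ[F] V →ₗ[F] W)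
    (hb : ∀ (a c : ZMod 2) (v w' : V), v ∈ gr F V a → w' ∈ gr F V c →
      b v w' = sgn F a c • b w' v) : GammaData F V W where
  gam v := (2 : F)⁻¹ • b v v
  bil := b
  gam_smul c v _ := by
    simp only [map_smul, LinearMap.smul_apply, smul_smul]
    congr 1; ring
  gam_add v w' hv hw := by
    have := hb 0 0 w' v hw hv
    simp only [sgn, zero_ne_one, false_and, if_false, one_smul] at this
    simp only [map_add, LinearMap.add_apply, this, smul_add]
    have h : b v w' = (2 : F)⁻¹ • b v w' + (2 : F)⁻¹ • b v w' := by
      rw [← smul_add, ← two_smul F, smul_smul, inv_mul_cancel₀ h2, one_smul]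
    conv_rhs => rw [h]
    abel
  bil_symm := hb
  bil_alt v hv := by
    have := hb 1 1 v v hv hv
    simp only [sgn, and_self, if_true, neg_smul, one_smul] at this
    have h : (2 : F) • b v v = 0 := by
      rw [two_smul]; nth_rewrite 1 [this]; simp
    exact (smul_eq_zero.1 h).resolve_left h2

theorem h14_gamma {F : Type u} [Field F] (h2 : (2 : F) ≠ 0)
    {V : Type v} [AddCommGroup V] [Module F V] [SuperModule F V]
    {G : Type w} [AddCommGroup G] [Module F G] (d : GammaData F V G) (hG : IsGamma F V G d)
    {T : Type x} [AddCommGroup T] [Module F T] (b : V →ₗ[F] V →ₗ[F] T)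
    (hb : ∀ (a c : ZMod 2) (v w' : V), v ∈ gr F V a → w' ∈ gr F V c →
      b v w' = sgn F a c • b w' v) :
    ∃ ψ : G →ₗ[F] T, (∀ v ∈ gr F V 0, ψ (d.gam v) = (2 : F)⁻¹ • b v v) ∧
      (∀ v w', ψ (d.bil v w') = b v w') ∧
      LinearMap.range ψ ≤ LinearMap.range (TensorProduct.lift b) := by
  set L := TensorProduct.lift b with hL
  let W' := ULift.{max u w} ((V ⊗[F] V) ⧸ LinearMap.ker L)
  let f : W' →ₗ[F] T := (Submodule.liftQ _ L le_rfl) ∘ₗ ULift.moduleEquiv.toLinearMap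
  have hf : Function.Injective f := by
    have : Function.Injective (Submodule.liftQ _ L (le_refl (LinearMap.ker L))) := by
      rw [← LinearMap.ker_eq_bot]
      exact Submodule.ker_liftQ_eq_bot _ _ _ le_rfl
    exact this.comp (ULift.moduleEquiv (R := F)).injective
  let b' : V →ₗ[F] V →ₗ[F] W' := (TensorProduct.mk F V V).compr₂
    (ULift.moduleEquiv.symm.toLinearMap ∘ₗ (LinearMap.ker L).mkQ)
  have hfb : ∀ v w', f (b' v w') = b v w' := by
    intro v w'
    change L (v ⊗ₜ w') = _
    simp [hL]
  have hb' : ∀ (a c : ZMod 2) (v w' : V), v ∈ gr F V a → w' ∈ gr F V c →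
      b' v w' = sgn F a c • b' w' v := by
    intro a c v w' hv hw
    apply hf
    rw [map_smul, hfb, hfb, hb a c v w' hv hw]
  obtain ⟨h, ⟨hg, hbil⟩, -⟩ := hG W' (h14_data h2 b' hb')
  refine ⟨f ∘ₗ h, ?_, ?_, ?_⟩
  · intro v hv
    rw [LinearMap.comp_apply, hg v hv]
    simp only [h14_data, map_smul, hfb]
  · intro v w'
    rw [LinearMap.comp_apply, hbil]
    simp only [h14_data, hfb]
  · refine (LinearMap.range_comp_le_range _ _).trans ?_
    refine (LinearMap.range_comp_le_range _ _).trans ?_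
    rw [Submodule.range_liftQ]

theorem h14_core {F : Type u} [Field F] (h2 : (2 : F) ≠ 0)
    {V : Type v} [AddCommGroup V] [Module F V] [SuperModule F V]
    {G : Type w} [AddCommGroup G] [Module F G] (d : GammaData F V G) (hG : IsGamma F V G d)
    {T : Type x} [AddCommGroup T] [Module F T] {N : Type y} [AddCommGroup N] [Module F N]
    {gN : ZMod 2 → Submodule F N} (hc : IsCompl (gN 0) (gN 1))
    (θ : N →ₗ[F] V) (hθs : Function.Surjective θ) (hθ : ∀ a x, x ∈ gN a → θ x ∈ gr F V a)
    (q : N →ₗ[F] N →ₗ[F] T)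
    (hvan : ∀ B : N →ₗ[F] N →ₗ[F] T, (∀ (a b : ZMod 2) (x y : N), x ∈ gN a → y ∈ gN b →
      B x y = q x y + sgn F a b • q y x) → ∀ (a : ZMod 2) (x y : N), x ∈ gN a →
      θ y = 0 → B x y = 0) :
    ∃ ψ : G →ₗ[F] T, (∀ x ∈ gN 0, ψ (d.gam (θ x)) = q x x) ∧
      (∀ (a b : ZMod 2) (x y : N), x ∈ gN a → y ∈ gN b →
        ψ (d.bil (θ x) (θ y)) = q x y + sgn F a b • q y x) ∧
      ∀ S : Submodule F T, (∀ (a b : ZMod 2) (x y : N), x ∈ gN a → y ∈ gN b →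
        q x y + sgn F a b • q y x ∈ S) → LinearMap.range ψ ≤ S := by
  obtain ⟨B, hB⟩ := h14_exists_B hc q
  have hsym : ∀ (a b : ZMod 2) (x y : N), x ∈ gN a → y ∈ gN b →
      B x y = sgn F a b • B y x := by
    intro a b x y hx hy
    rw [hB a b x y hx hy, hB b a y x hy hx, smul_add, smul_smul, h14_sgn_symm F b a,
      h14_sgn_sq, one_smul, add_comm]
  have hr : ∀ x y, θ y = 0 → B x y = 0 := by
    intro x y hy
    obtain ⟨x0, h0, x1, h1, rfl⟩ := h14_decomp hc x
    rw [map_add, LinearMap.add_apply, hvan B hB 0 x0 y h0 hy, hvan B hB 1 x1 y h1 hy, add_zero]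
  have hl : ∀ x y, θ x = 0 → B x y = 0 := by
    intro x y hx
    obtain ⟨x0, h0, x1, h1, rfl⟩ := h14_decomp hc x
    obtain ⟨y0, k0, y1, k1, rfl⟩ := h14_decomp hc y
    obtain ⟨e0, e1⟩ := h14_comp (SuperModule.isCompl_grade (F := F) (V := V)) (hθ _ _ h0)
      (hθ _ _ h1) (Submodule.zero_mem _) (Submodule.zero_mem _)
      (by rw [← map_add, hx, add_zero])
    simp only [map_add, LinearMap.add_apply]
    rw [hsym _ _ _ _ h0 k0, hsym _ _ _ _ h0 k1, hsym _ _ _ _ h1 k0, hsym _ _ _ _ h1 k1,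
      hr _ _ e0, hr _ _ e1, hr _ _ e0, hr _ _ e1]
    simp
  obtain ⟨s, hs⟩ := LinearMap.exists_rightInverse_of_surjective θ (LinearMap.range_eq_top.2 hθs)
  have hs' : ∀ v, θ (s v) = v := fun v => LinearMap.congr_fun hs v
  let b : V →ₗ[F] V →ₗ[F] T := B.compl₁₂ s s
  have hbB : ∀ x y, b (θ x) (θ y) = B x y := by
    intro x y
    have e1 : B (s (θ x) - x) (s (θ y)) = 0 := hl _ _ (by simp [hs'])
    have e2 : B x (s (θ y) - y) = 0 := hr _ _ (by simp [hs'])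
    rw [map_sub, LinearMap.sub_apply, sub_eq_zero] at e1
    rw [map_sub, sub_eq_zero] at e2
    simp only [b, LinearMap.compl₁₂_apply]
    rw [e1, e2]
  have hb : ∀ (a c : ZMod 2) (v w' : V), v ∈ gr F V a → w' ∈ gr F V c →
      b v w' = sgn F a c • b w' v := by
    intro a c v w' hv hw
    obtain ⟨x, rfl⟩ := hθs v
    obtain ⟨y, rfl⟩ := hθs w'
    obtain ⟨x', hx', ex⟩ := h14_lift hc θ hθ a x hv
    obtain ⟨y', hy', ey⟩ := h14_lift hc θ hθ c y hw
    rw [← ex, ← ey, hbB, hbB]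
    exact hsym _ _ _ _ hx' hy'
  obtain ⟨ψ, h1, h3, h4⟩ := h14_gamma h2 d hG b hb
  refine ⟨ψ, ?_, ?_, ?_⟩
  · intro x hx
    rw [h1 _ (hθ _ _ hx), hbB, hB 0 0 x x hx hx]
    simp only [sgn, zero_ne_one, false_and, if_false, one_smul]
    rw [← two_smul F, smul_smul, inv_mul_cancel₀ h2, one_smul]
  · intro a b x y hx hy
    rw [h3, hbB, hB a b x y hx hy]
  · intro S hS
    refine h4.trans ?_
    rintro _ ⟨t, rfl⟩
    have hBS : ∀ x y, B x y ∈ S := by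
      intro x y
      obtain ⟨x0, h0, x1, h1, rfl⟩ := h14_decomp hc x
      obtain ⟨y0, k0, y1, k1, rfl⟩ := h14_decomp hc y
      simp only [map_add, LinearMap.add_apply]
      have key : ∀ a b x y, x ∈ gN a → y ∈ gN b → B x y ∈ S := by
        intro a b x y hx hy
        rw [hB a b x y hx hy]; exact hS a b x y hx hy
      exact S.add_mem (S.add_mem (key _ _ _ _ h0 k0) (key _ _ _ _ h1 k0))
        (S.add_mem (key _ _ _ _ h0 k1) (key _ _ _ _ h1 k1))
    induction t with
    | zero => simp
    | tmul v w' => exact hBS _ _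
    | add p r hp hr => rw [map_add]; exact S.add_mem hp hr

theorem h14_alg {F : Type u} [Field F] {T : Type v} [AddCommGroup T] [Module F T]
    (a b c : ZMod 2) (A X D E Y : T)
    (h1 : A = X - sgn F a b • (-(sgn F a c) • D))
    (h2 : D = sgn F a (b + c) • A - sgn F b c • E)
    (h3 : Y = -(sgn F b c) • E) : X + sgn F a (b + c) • Y = 0 := by
  have h4 : D = sgn F a (b + c) • A + Y := by rw [h2, h3, neg_smul, sub_eq_add_neg]
  have h5 : A = X + sgn F a (b + c) • D := by
    conv_lhs => rw [h1]
    rw [h14_sgn_add, smul_smul, mul_neg, neg_smul, sub_neg_eq_add]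
  have h6 : A = X + (A + sgn F a (b + c) • Y) := by
    conv_lhs => rw [h5, h4]
    rw [smul_add, smul_smul, h14_sgn_sq, one_smul]
  have h7 : A + (X + sgn F a (b + c) • Y) = A + 0 := by
    rw [add_zero]; nth_rewrite 2 [h6]; abel
  exact add_left_cancel h7

theorem h14_refl_gr {F : Type u} [Field F] {I : Type v} [AddCommGroup I] [Module F I]
    [SuperModule F I] {M : Type w} [AddCommGroup M] [Module F M] [SuperModule F M]
    (f : I →ₗ[F] M) (hf : Function.Injective f) (hg : ∀ a x, x ∈ gr F I a → f x ∈ gr F M a)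
    (a : ZMod 2) (x : I) (hx : f x ∈ gr F M a) : x ∈ gr F I a := by
  obtain ⟨x', h, e⟩ := h14_lift (SuperModule.isCompl_grade (F := F) (V := I)) f hg a x hx
  exact hf e ▸ h

theorem h14_section {F : Type u} [Field F] {I : Type v} [AddCommGroup I] [Module F I]
    {M : Type w} [AddCommGroup M] [Module F M]
    (f : I →ₗ[F] M) (N : Submodule F M) (hN : N ≤ LinearMap.range f)
    (hf : Function.Injective f) :
    ∃ g : N →ₗ[F] I, ∀ x, f (g x) = x := by
  refine ⟨(LinearEquiv.ofInjective f hf).symm.toLinearMap ∘ₗ Submodule.inclusion hN, ?_⟩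
  intro x
  have := (LinearEquiv.ofInjective f hf).apply_symm_apply (Submodule.inclusion hN x)
  exact congrArg Subtype.val this

theorem h14_compl {F : Type u} [Field F] {I : Type v} [AddCommGroup I] [Module F I]
    [SuperModule F I] {J : Type x} [AddCommGroup J] [Module F J] [SuperModule F J]
    {M : Type w} [AddCommGroup M] [Module F M] [SuperModule F M]
    (f : I →ₗ[F] M) (hg : ∀ a x, x ∈ gr F I a → f x ∈ gr F M a)
    (g : J →ₗ[F] M) (hg' : ∀ a x, x ∈ gr F J a → g x ∈ gr F M a) :
    IsCompl ((gr F M 0).comap (LinearMap.range f ⊓ LinearMap.range g).subtype)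
      ((gr F M 1).comap (LinearMap.range f ⊓ LinearMap.range g).subtype) := by
  have hM := SuperModule.isCompl_grade (F := F) (V := M)
  constructor
  · rw [Submodule.disjoint_def]
    intro x h0 h1
    exact Subtype.ext (Submodule.disjoint_def.1 hM.disjoint _ h0 h1)
  · rw [codisjoint_iff, eq_top_iff]
    rintro ⟨x, ⟨i, hi⟩, ⟨j, hj⟩⟩ -
    obtain ⟨i0, hi0, i1, hi1, rfl⟩ :=
      h14_decomp (SuperModule.isCompl_grade (F := F) (V := I)) i
    obtain ⟨j0, hj0, j1, hj1, rfl⟩ :=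
      h14_decomp (SuperModule.isCompl_grade (F := F) (V := J)) j
    obtain ⟨e0, e1⟩ := h14_comp hM (hg _ _ hi0) (hg _ _ hi1) (hg' _ _ hj0) (hg' _ _ hj1)
      (by rw [← map_add, ← map_add, hi, hj])
    refine Submodule.mem_sup.2 ⟨⟨f i0, ⟨i0, rfl⟩, ⟨j0, e0.symm⟩⟩, hg _ _ hi0,
      ⟨f i1, ⟨i1, rfl⟩, ⟨j1, e1.symm⟩⟩, hg _ _ hi1, ?_⟩
    apply Subtype.ext
    simpa using hi

end Helpers


theorem stmt_14 (F : Type*) [Field F] (hchar2 : ringChar F ≠ 2) (hchar3 : ringChar F ≠ 3)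
    (M : Type*) [AddCommGroup M] [Module F M] [SuperModule F M] [LieSuperAlgebra F M]
    (T : Type*) [AddCommGroup T] [Module F T] [SuperModule F T] [LieSuperAlgebra F T]
    (p : TensorSqPairing F M T) (hT : IsTensorSquare F M T p)
    (Q : Type*) [AddCommGroup Q] [Module F Q] [SuperModule F Q] [LieSuperAlgebra F Q]
    (π : LieSuperHom F M Q) (hπs : Function.Surjective π.toLinearMap)
    (hπk : LinearMap.ker π.toLinearMap = derivedSub F M)
    (G : Type*) [AddCommGroup G] [Module F G]
    (d : GammaData F Q G) (hG : IsGamma F Q G d)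
    (I : Type*) [AddCommGroup I] [Module F I] [SuperModule F I] [LieSuperAlgebra F I]
    (J : Type*) [AddCommGroup J] [Module F J] [SuperModule F J] [LieSuperAlgebra F J]
    (ι : LieSuperHom F I M) (hιinj : Function.Injective ι.toLinearMap)
    (hI : ∀ (x : M) (u : I),
      br F M x (ι.toLinearMap u) ∈ LinearMap.range ι.toLinearMap)
    (κ : LieSuperHom F J M) (hκinj : Function.Injective κ.toLinearMap)
    (hJ : ∀ (x : M) (u : J),
      br F M x (κ.toLinearMap u) ∈ LinearMap.range κ.toLinearMap)
    (α : LieSuperAction F I J)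
    (hα : ∀ (i : I) (j : J),
      κ.toLinearMap (α.act i j) = br F M (ι.toLinearMap i) (κ.toLinearMap j))
    (β : LieSuperAction F J I)
    (hβ : ∀ (j : J) (i : I),
      ι.toLinearMap (β.act j i) = br F M (κ.toLinearMap j) (ι.toLinearMap i))
    (TIJ : Type*) [AddCommGroup TIJ] [Module F TIJ] [SuperModule F TIJ] [LieSuperAlgebra F TIJ]
    (pIJ : SuperPairing F I J TIJ α β)
    (hTIJ : IsTensorProductLSA F I J TIJ α β pIJ)
    (V : Type*) [AddCommGroup V] [Module F V] [SuperModule F V]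
    (θ : ↥(LinearMap.range ι.toLinearMap ⊓ LinearMap.range κ.toLinearMap) →ₗ[F] V)
    (hθs : Function.Surjective θ)
    (hθk : LinearMap.ker θ =
      Submodule.comap (LinearMap.range ι.toLinearMap ⊓ LinearMap.range κ.toLinearMap).subtype
        (bracketSub F M (LinearMap.range ι.toLinearMap) (LinearMap.range κ.toLinearMap)))
    (hθg : ∀ (a : ZMod 2)
      (x : ↥(LinearMap.range ι.toLinearMap ⊓ LinearMap.range κ.toLinearMap)),
      (x : M) ∈ gr F M a → θ x ∈ gr F V a)
    (GV : Type*) [AddCommGroup GV] [Module F GV]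
    (dV : GammaData F V GV) (hGV : IsGamma F V GV dV) :
    (∃ ψ : G →ₗ[F] T,
      (∀ x : M, x ∈ gr F M 0 → ψ (d.gam (π.toLinearMap x)) = p.pair x x) ∧
      (∀ (a b : ZMod 2) (x y : M), x ∈ gr F M a → y ∈ gr F M b →
        ψ (d.bil (π.toLinearMap x) (π.toLinearMap y))
          = p.pair x y + sgn F a b • p.pair y x) ∧
      LinearMap.range ψ = squareBox F M T p ∧
      Function.Surjective (squareBox F M T p).mkQ) ∧
    (∃ ψ' : GV →ₗ[F] TIJ,
      (∀ (x : ↥(LinearMap.range ι.toLinearMap ⊓ LinearMap.range κ.toLinearMap))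
        (i : I) (j : J),
        ι.toLinearMap i = (x : M) → κ.toLinearMap j = (x : M) → (x : M) ∈ gr F M 0 →
        ψ' (dV.gam (θ x)) = pIJ.pair i j) ∧
      (∀ (a b : ZMod 2)
        (x y : ↥(LinearMap.range ι.toLinearMap ⊓ LinearMap.range κ.toLinearMap))
        (i i' : I) (j j' : J),
        ι.toLinearMap i = (x : M) → κ.toLinearMap j = (x : M) →
        ι.toLinearMap i' = (y : M) → κ.toLinearMap j' = (y : M) →
        (x : M) ∈ gr F M a → (y : M) ∈ gr F M b →
        ψ' (dV.bil (θ x) (θ y)) = pIJ.pair i j' + sgn F a b • pIJ.pair i' j) ∧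
      LinearMap.range ψ' = pairBox F I J TIJ M ι κ α β pIJ ∧
      Function.Surjective (pairBox F I J TIJ M ι κ α β pIJ).mkQ) := by
  have h2 : (2 : F) ≠ 0 := Ring.two_ne_zero hchar2
  constructor
  · have hM := SuperModule.isCompl_grade (F := F) (V := M)
    obtain ⟨ψ, hψ1, hψ2, hψ3⟩ := h14_core h2 d hG (gN := gr F M) hM π.toLinearMap hπs
      π.map_grade p.pair (by
        intro B hB a x y hx hy
        have hy' : y ∈ derivedSub F M := by rw [← hπk]; exact hy
        have hle : derivedSub F M ≤ LinearMap.ker (B x) := by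
          refine Submodule.span_le.2 ?_
          rintro _ ⟨m, n, rfl⟩
          have key : ∀ (b c : ZMod 2) (m n : M), m ∈ gr F M b → n ∈ gr F M c →
              br F M m n ∈ LinearMap.ker (B x) := by
            intro b c m n hm hn
            rw [LinearMap.mem_ker, hB a (b + c) x _ hx
              (LieSuperAlgebra.bracket_grade b c m n hm hn)]
            refine h14_alg a b c (p.pair (br F M x m) n) _ (p.pair m (br F M n x))
              (p.pair (br F M n m) x) _ ?_ ?_ ?_
            · have e1 : br F M x n = -(sgn F a c) • br F M n x :=
                LieSuperAlgebra.skew a c x n hx hn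
              rw [p.rel1 a b x m n hx hm, e1, map_smul]
            · exact p.rel2 b c a m n x hm hn hx
            · rw [← LinearMap.smul_apply, ← map_smul, ← LieSuperAlgebra.skew b c m n hm hn]
          obtain ⟨m0, hm0, m1, hm1, rfl⟩ := h14_decomp hM m
          obtain ⟨n0, hn0, n1, hn1, rfl⟩ := h14_decomp hM n
          simp only [map_add, LinearMap.add_apply]
          exact add_mem (add_mem (key _ _ _ _ hm0 hn0) (key _ _ _ _ hm1 hn0))
            (add_mem (key _ _ _ _ hm0 hn1) (key _ _ _ _ hm1 hn1))
        exact hle hy')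
    refine ⟨ψ, hψ1, hψ2, le_antisymm ?_ ?_, Submodule.mkQ_surjective _⟩
    · refine hψ3 _ ?_
      intro a b x y hx hy
      exact Submodule.subset_span (Or.inl ⟨a, b, x, y, hx, hy, rfl⟩)
    · refine Submodule.span_le.2 ?_
      rintro t (⟨a, b, x, y, hx, hy, rfl⟩ | ⟨x, hx, rfl⟩)
      · exact ⟨_, hψ2 a b x y hx hy⟩
      · exact ⟨_, hψ1 x hx⟩
  · have hIc := SuperModule.isCompl_grade (F := F) (V := I)
    have hJc := SuperModule.isCompl_grade (F := F) (V := J)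
    obtain ⟨f, hf⟩ := h14_section ι.toLinearMap
      (LinearMap.range ι.toLinearMap ⊓ LinearMap.range κ.toLinearMap) inf_le_left hιinj
    obtain ⟨g, hg⟩ := h14_section κ.toLinearMap
      (LinearMap.range ι.toLinearMap ⊓ LinearMap.range κ.toLinearMap) inf_le_right hκinj
    obtain ⟨ψ, hψ1, hψ2, hψ3⟩ := h14_core h2 dV hGV
      (gN := fun a => (gr F M a).comap
        (LinearMap.range ι.toLinearMap ⊓ LinearMap.range κ.toLinearMap).subtype)
      (h14_compl ι.toLinearMap ι.map_grade κ.toLinearMap κ.map_grade) θ hθs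
      hθg (pIJ.pair.compl₁₂ f g) (by
        intro B hB a x y hx hy
        have hfx : f x ∈ gr F I a :=
          h14_refl_gr ι.toLinearMap hιinj ι.map_grade a _ (by rw [hf]; exact hx)
        have hgx : g x ∈ gr F J a :=
          h14_refl_gr κ.toLinearMap hκinj κ.map_grade a _ (by rw [hg]; exact hx)
        have hy' : (y : M) ∈ bracketSub F M (LinearMap.range ι.toLinearMap)
            (LinearMap.range κ.toLinearMap) := by
          have : y ∈ LinearMap.ker θ := hy
          rw [hθk] at this
          exact this
        have hle : bracketSub F M (LinearMap.range ι.toLinearMap)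
            (LinearMap.range κ.toLinearMap) ≤ (LinearMap.ker (B x)).map
              (LinearMap.range ι.toLinearMap ⊓ LinearMap.range κ.toLinearMap).subtype := by
          refine Submodule.span_le.2 ?_
          rintro _ ⟨_, ⟨m, rfl⟩, _, ⟨n, rfl⟩, rfl⟩
          have key : ∀ (b c : ZMod 2) (m : I) (n : J), m ∈ gr F I b → n ∈ gr F J c →
              br F M (ι.toLinearMap m) (κ.toLinearMap n) ∈ (LinearMap.ker (B x)).map
              (LinearMap.range ι.toLinearMap ⊓ LinearMap.range κ.toLinearMap).subtype := by
            intro b c m n hm hn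
            have hsk := LieSuperAlgebra.skew (F := F) b c _ _ (ι.map_grade b m hm)
              (κ.map_grade c n hn)
            have hmemJ : κ.toLinearMap (α.act m n) =
              br F M (ι.toLinearMap m) (κ.toLinearMap n) := hα m n
            have hmemI : ι.toLinearMap (-(sgn F b c) • β.act n m) =
              br F M (ι.toLinearMap m) (κ.toLinearMap n) := by
              rw [map_smul, hβ]; exact hsk.symm
            let t : ↥(LinearMap.range ι.toLinearMap ⊓ LinearMap.range κ.toLinearMap) :=
              ⟨br F M (ι.toLinearMap m) (κ.toLinearMap n), ⟨_, hmemI⟩, ⟨_, hmemJ⟩⟩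
            have hft : f t = -(sgn F b c) • β.act n m := hιinj (by rw [hf, hmemI])
            have hgt : g t = α.act m n := hκinj (by rw [hg, hmemJ])
            refine ⟨t, ?_, rfl⟩
            rw [SetLike.mem_coe, LinearMap.mem_ker, hB a (b + c) x t hx
              (LieSuperAlgebra.bracket_grade b c _ _ (ι.map_grade b m hm)
              (κ.map_grade c n hn))]
            simp only [LinearMap.compl₁₂_apply]
            rw [hft, hgt]
            have e1 : α.act (f x) n = -(sgn F a c) • br F J n (g x) := by
              apply hκinj
              rw [hα, map_smul, κ.map_bracket, hf, hg]
              exact LieSuperAlgebra.skew (F := F) a c _ _ hx (κ.map_grade c n hn)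
            have e2 : β.act (g x) m = br F I (f x) m := by
              apply hιinj
              rw [hβ, ι.map_bracket, hf, hg]
            refine h14_alg a b c (pIJ.pair (br F I (f x) m) n) _
              (pIJ.pair m (br F J n (g x))) (pIJ.pair (β.act n m) (g x)) _ ?_ ?_ ?_
            · rw [pIJ.rel1 a b (f x) m n hfx hm, e1, map_smul]
            · rw [← e2]
              exact pIJ.rel2 b c a m n (g x) hm hn hgx
            · rw [map_smul, LinearMap.smul_apply]
          obtain ⟨m0, hm0, m1, hm1, rfl⟩ := h14_decomp hIc m
          obtain ⟨n0, hn0, n1, hn1, rfl⟩ := h14_decomp hJc n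
          simp only [map_add, LinearMap.add_apply]
          exact add_mem (add_mem (key _ _ _ _ hm0 hn0) (key _ _ _ _ hm1 hn0))
            (add_mem (key _ _ _ _ hm0 hn1) (key _ _ _ _ hm1 hn1))
        obtain ⟨y', hy1, hy2⟩ := hle hy'
        have : y' = y := Subtype.ext hy2
        exact this ▸ hy1)
    have hfi : ∀ (x : ↥(LinearMap.range ι.toLinearMap ⊓ LinearMap.range κ.toLinearMap)) (i : I),
        ι.toLinearMap i = (x : M) → f x = i := fun x i h => hιinj (by rw [hf, h])
    have hgj : ∀ (x : ↥(LinearMap.range ι.toLinearMap ⊓ LinearMap.range κ.toLinearMap)) (j : J),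
        κ.toLinearMap j = (x : M) → g x = j := fun x j h => hκinj (by rw [hg, h])
    have hA : ∀ (x : ↥(LinearMap.range ι.toLinearMap ⊓ LinearMap.range κ.toLinearMap))
        (i : I) (j : J),
        ι.toLinearMap i = (x : M) → κ.toLinearMap j = (x : M) → (x : M) ∈ gr F M 0 →
        ψ (dV.gam (θ x)) = pIJ.pair i j := by
      intro x i j hi hj hx
      rw [hψ1 x hx, LinearMap.compl₁₂_apply, hfi x i hi, hgj x j hj]
    have hBB : ∀ (a b : ZMod 2)
        (x y : ↥(LinearMap.range ι.toLinearMap ⊓ LinearMap.range κ.toLinearMap))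
        (i i' : I) (j j' : J),
        ι.toLinearMap i = (x : M) → κ.toLinearMap j = (x : M) →
        ι.toLinearMap i' = (y : M) → κ.toLinearMap j' = (y : M) →
        (x : M) ∈ gr F M a → (y : M) ∈ gr F M b →
        ψ (dV.bil (θ x) (θ y)) = pIJ.pair i j' + sgn F a b • pIJ.pair i' j := by
      intro a b x y i i' j j' hi hj hi' hj' hx hy
      rw [hψ2 a b x y hx hy, LinearMap.compl₁₂_apply, LinearMap.compl₁₂_apply, hfi x i hi,
        hgj x j hj, hfi y i' hi', hgj y j' hj']
    refine ⟨ψ, hA, hBB, le_antisymm ?_ ?_, Submodule.mkQ_surjective _⟩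
    · refine hψ3 _ ?_
      intro a b x y hx hy
      refine Submodule.subset_span (Or.inl ⟨a, b, f x, f y, g x, g y, ?_, ?_, ?_, ?_, rfl⟩)
      · rw [hf, hg]
      · rw [hf, hg]
      · rw [hf]; exact hx
      · rw [hf]; exact hy
    · refine Submodule.span_le.2 ?_
      rintro t (⟨a, b, i, i', j, j', h, h', hx, hy, rfl⟩ | ⟨i, j, h, hx, rfl⟩)
      · exact ⟨_, hBB a b ⟨ι.toLinearMap i, ⟨i, rfl⟩, ⟨j, h.symm⟩⟩
          ⟨ι.toLinearMap i', ⟨i', rfl⟩, ⟨j', h'.symm⟩⟩ i i' j j' rfl h.symm rfl h'.symm hx hy⟩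
      · exact ⟨_, hA ⟨ι.toLinearMap i, ⟨i, rfl⟩, ⟨j, h.symm⟩⟩ i j rfl h.symm hx⟩
end

section
/- Let M be a free supermodule over a field of characteristic ≠ 2, 3 with an ordered homogeneous basis {x_i}_{i ∈ I₀} ∪ {x_i}_{i ∈ I₁}, where the even basis elements (indexed by I₀) precede the odd ones (indexed by I₁). Then Γ(M) is a free supermodule with basis {γ(x_i)}_{i ∈ I₀} ∪ {b_γ(x_i, x_j)}_{i, j ∈ I₀ ∪ I₁, i < j}. -/
open Module Function TensorProduct

universe u v w x y z

theorem coord_zero {F M idx : Type*} [Field F] [AddCommGroup M] [Module F M]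
    (v : Basis idx F M) (p q : Submodule F M) (hpq : IsCompl p q)
    (hhom : ∀ i, v i ∈ p ∨ v i ∈ q) (i : idx) (hi : v i ∈ p) (x : M) (hx : x ∈ q) :
    v.coord i x = 0 := by
  have key : (v.coord i) ∘ₗ p.projection q hpq = v.coord i := by
    apply v.ext
    intro j
    simp only [LinearMap.comp_apply]
    rcases hhom j with h | h
    · rw [Submodule.projection_apply_left hpq ⟨v j, h⟩]
    · rw [(Submodule.projection_apply_eq_zero_iff hpq).2 h]
      have hij : j ≠ i := by
        rintro rfl
        exact v.ne_zero j (Submodule.disjoint_def.1 hpq.disjoint _ hi h)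
      simp [hij]
  rw [← key, LinearMap.comp_apply, (Submodule.projection_apply_eq_zero_iff hpq).2 hx,
    map_zero]

theorem zmod2_cases (a : ZMod 2) : a = 0 ∨ a = 1 := by
  revert a; decide

/-- Gamma data from a supersymmetric bilinear map. -/
def gammaOfBil {F : Type*} [Field F] (h2 : (2 : F) ≠ 0)
    {M : Type*} [AddCommGroup M] [Module F M] [SuperModule F M]
    {W : Type*} [AddCommGroup W] [Module F W]
    (b : M →ₗ[F] M →ₗ[F] W)
    (h00 : ∀ x y, x ∈ gr F M 0 → y ∈ gr F M 0 → b x y = b y x)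
    (h01 : ∀ x y, x ∈ gr F M 0 → y ∈ gr F M 1 → b x y = b y x)
    (h11 : ∀ x y, x ∈ gr F M 1 → y ∈ gr F M 1 → b x y = - b y x) : GammaData F M W where
  gam x := (2 : F)⁻¹ • b x x
  bil := b
  gam_smul c x _ := by
    simp only [map_smul, LinearMap.smul_apply, smul_smul]
    congr 1; ring
  gam_add x y hx hy := by
    have : b x y = (2 : F)⁻¹ • (b x y + b y x) := by
      rw [h00 y x hy hx, ← two_smul F, smul_smul, inv_mul_cancel₀ h2, one_smul]
    rw [this]
    simp only [map_add, LinearMap.add_apply, smul_add]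
    abel
  bil_symm a c x y hx hy := by
    rcases zmod2_cases a with rfl | rfl <;> rcases zmod2_cases c with rfl | rfl
    · simpa [sgn] using h00 x y hx hy
    · simpa [sgn] using h01 x y hx hy
    · simpa [sgn] using (h01 y x hy hx).symm
    · simpa [sgn] using h11 x y hx hy
  bil_alt x hx := by
    have h := h11 x x hx hx
    have h' : (2 : F) • b x x = 0 := by
      rw [two_smul]; nth_rw 1 [h]; simp
    exact (smul_eq_zero.1 h').resolve_left h2

/-- The bilinear form `x_i y_j`. -/
noncomputable def coordBil {F M idx : Type*} [Field F] [AddCommGroup M] [Module F M]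
    (v : Basis idx F M) (i j : idx) : M →ₗ[F] M →ₗ[F] F :=
  LinearMap.mk₂ F (fun x y => v.coord i x * v.coord j y)
    (by intros; simp [add_mul]) (by intros; simp [mul_assoc])
    (by intros; simp [mul_add]) (by intros; simp [mul_left_comm])

theorem coordBil_apply {F M idx : Type*} [Field F] [AddCommGroup M] [Module F M]
    (v : Basis idx F M) (i j : idx) (x y : M) :
    coordBil v i j x y = v.coord i x * v.coord j y := rfl

theorem exists_dual {F : Type u} [Field F] (h2 : (2 : F) ≠ 0)
    {M : Type v} [AddCommGroup M] [Module F M] [SuperModule F M]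
    {G : Type w} [AddCommGroup G] [Module F G]
    (d : GammaData F M G) (hG : IsGamma F M G d)
    (b : M →ₗ[F] M →ₗ[F] F)
    (h00 : ∀ x y, x ∈ gr F M 0 → y ∈ gr F M 0 → b x y = b y x)
    (h01 : ∀ x y, x ∈ gr F M 0 → y ∈ gr F M 1 → b x y = b y x)
    (h11 : ∀ x y, x ∈ gr F M 1 → y ∈ gr F M 1 → b x y = - b y x) :
    ∃ f : G →ₗ[F] F, (∀ x ∈ gr F M 0, f (d.gam x) = 2⁻¹ * b x x) ∧
      (∀ x y, f (d.bil x y) = b x y) := by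
  let e : F ≃ₗ[F] ULift.{max u v w} F := ULift.moduleEquiv.symm
  obtain ⟨h, ⟨hg, hb⟩, -⟩ := hG (ULift.{max u v w} F)
    (gammaOfBil h2 (b.compr₂ e.toLinearMap)
      (fun x y hx hy => by simp [h00 x y hx hy])
      (fun x y hx hy => by simp [h01 x y hx hy])
      (fun x y hx hy => by simp [h11 x y hx hy]))
  refine ⟨e.symm.toLinearMap ∘ₗ h, fun x hx => ?_, fun x y => ?_⟩
  · simp [hg x hx, gammaOfBil]
  · simp [hb, gammaOfBil]

theorem gamma_span {F : Type u} [Field F] 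
    {M : Type v} [AddCommGroup M] [Module F M] [SuperModule F M]
    {G : Type w} [AddCommGroup G] [Module F G]
    (d : GammaData F M G) (hG : IsGamma F M G d) (S : Submodule F G)
    (hg : ∀ x ∈ gr F M 0, d.gam x ∈ S) (hb : ∀ x y, d.bil x y ∈ S) : S = ⊤ := by
  let e : (G ⧸ S) ≃ₗ[F] ULift.{max u v w} (G ⧸ S) := ULift.moduleEquiv.symm
  have d' : {d' : GammaData F M (ULift.{max u v w} (G ⧸ S)) // d'.gam = 0 ∧ d'.bil = 0} :=
    ⟨⟨0, 0, by simp, by simp, by simp, by simp⟩, rfl, rfl⟩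
  obtain ⟨d', h1, h2⟩ := d'
  have hu := (hG _ d').unique (y₁ := e.toLinearMap ∘ₗ S.mkQ) (y₂ := 0)
    ⟨fun x hx => by
      have := (Submodule.Quotient.mk_eq_zero S).2 (hg x hx)
      simp [h1, this], fun x y => by
      have := (Submodule.Quotient.mk_eq_zero S).2 (hb x y)
      simp [h2, this]⟩ ⟨fun x hx => by simp [h1], fun x y => by simp [h2]⟩
  rw [eq_top_iff]
  intro g _
  have h3 := LinearMap.congr_fun hu g
  rw [← Submodule.Quotient.mk_eq_zero S]
  simpa using h3

theorem gam_self {F : Type*} [Field F] (h2 : (2 : F) ≠ 0)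
    {M : Type*} [AddCommGroup M] [Module F M] [SuperModule F M]
    {G : Type*} [AddCommGroup G] [Module F G]
    (d : GammaData F M G) (x : M) (hx : x ∈ gr F M 0) : d.bil x x = (2 : F) • d.gam x := by
  rw [← d.gam_add x x hx hx, ← two_smul F x, d.gam_smul 2 x hx]
  module

theorem ite_mul_ite_helper {F : Type*} [Field F] (p q : Prop) [Decidable p] [Decidable q] :
    (if p then (1 : F) else 0) * (if q then 1 else 0) = if p ∧ q then 1 else 0 := by
  by_cases p <;> by_cases q <;> simp [*]

theorem stmt_16 (F : Type*) [Field F] (hchar2 : ringChar F ≠ 2) (hchar3 : ringChar F ≠ 3)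
    (M : Type*) [AddCommGroup M] [Module F M] [SuperModule F M]
    (idx : Type*) [LinearOrder idx] (v : Basis idx F M)
    (hhom : ∀ i, v i ∈ gr F M 0 ∨ v i ∈ gr F M 1)
    (horder : ∀ i j, v i ∈ gr F M 0 → v j ∈ gr F M 1 → i ≤ j)
    (G : Type*) [AddCommGroup G] [Module F G]
    (d : GammaData F M G) (hG : IsGamma F M G d) :
    ∃ B : Basis (({i : idx // v i ∈ gr F M 0}) ⊕ ({q : idx × idx // q.1 < q.2})) F G,
      (∀ i : {i : idx // v i ∈ gr F M 0}, B (Sum.inl i) = d.gam (v i.1)) ∧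
      (∀ q : {q : idx × idx // q.1 < q.2}, B (Sum.inr q) = d.bil (v q.1.1) (v q.1.2)) := by
  classical
  have h2 : (2 : F) ≠ 0 := Ring.two_ne_zero hchar2
  have hc : IsCompl (gr F M 0) (gr F M 1) := SuperModule.isCompl_grade
  have hev : ∀ i, v i ∈ gr F M 0 → ∀ x ∈ gr F M 1, v.coord i x = 0 :=
    fun i hi x hx => coord_zero v _ _ hc hhom i hi x hx
  have hod : ∀ i, v i ∈ gr F M 1 → ∀ x ∈ gr F M 0, v.coord i x = 0 :=
    fun i hi x hx => coord_zero v _ _ hc.symm (fun i => (hhom i).symm) i hi x hx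
  let fam : (({i : idx // v i ∈ gr F M 0}) ⊕ ({q : idx × idx // q.1 < q.2})) → G :=
    Sum.elim (fun i => d.gam (v i.1)) (fun q => d.bil (v q.1.1) (v q.1.2))
  -- spanning
  have hspan : ⊤ ≤ Submodule.span F (Set.range fam) := by
    have hlt : ∀ i j, i < j → d.bil (v i) (v j) ∈ Submodule.span F (Set.range fam) :=
      fun i j hij => Submodule.subset_span ⟨Sum.inr ⟨(i, j), hij⟩, rfl⟩
    have hvv : ∀ i j, d.bil (v i) (v j) ∈ Submodule.span F (Set.range fam) := by
      intro i j
      rcases lt_trichotomy i j with h | rfl | h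
      · exact hlt i j h
      · rcases hhom i with hi | hi
        · rw [gam_self h2 d _ hi]
          exact Submodule.smul_mem _ _ (Submodule.subset_span ⟨Sum.inl ⟨i, hi⟩, rfl⟩)
        · rw [d.bil_alt _ hi]; exact Submodule.zero_mem _
      · obtain ⟨a, ha⟩ : ∃ a, v i ∈ gr F M a := (hhom i).elim (fun h => ⟨0, h⟩) (fun h => ⟨1, h⟩)
        obtain ⟨b, hb⟩ : ∃ b, v j ∈ gr F M b := (hhom j).elim (fun h => ⟨0, h⟩) (fun h => ⟨1, h⟩)
        rw [d.bil_symm a b _ _ ha hb]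
        exact Submodule.smul_mem _ _ (hlt j i h)
    have hb : ∀ x y, d.bil x y ∈ Submodule.span F (Set.range fam) := by
      intro x y
      have hx : ∀ i, d.bil (v i) y ∈ Submodule.span F (Set.range fam) := by
        intro i
        have ht : ⊤ ≤ (Submodule.span F (Set.range fam)).comap (d.bil (v i)) := by
          rw [← v.span_eq, Submodule.span_le]
          rintro _ ⟨j, rfl⟩
          exact hvv i j
        exact ht (Submodule.mem_top (x := y))
      have ht : ⊤ ≤ (Submodule.span F (Set.range fam)).comap (d.bil.flip y) := by
        rw [← v.span_eq, Submodule.span_le]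
        rintro _ ⟨j, rfl⟩
        exact hx j
      exact ht (Submodule.mem_top (x := x))
    refine (gamma_span d hG _ (fun x hx => ?_) hb).ge
    have h3 : d.gam x = (2 : F)⁻¹ • d.bil x x := by
      rw [gam_self h2 d x hx, smul_smul, inv_mul_cancel₀ h2, one_smul]
    rw [h3]
    exact Submodule.smul_mem _ _ (hb x x)
  -- dual functionals
  have hdual1 : ∀ i : {i : idx // v i ∈ gr F M 0}, ∃ f : G →ₗ[F] F,
      (∀ x ∈ gr F M 0, f (d.gam x) = v.coord i.1 x * v.coord i.1 x) ∧
      (∀ x y, f (d.bil x y) = 2 * (v.coord i.1 x * v.coord i.1 y)) := by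
    rintro ⟨i, hi⟩
    obtain ⟨f, hf1, hf2⟩ := exists_dual h2 d hG ((2 : F) • coordBil v i i)
      (fun x y _ _ => by simp only [LinearMap.smul_apply, coordBil_apply]; rw [mul_comm])
      (fun x y _ _ => by simp only [LinearMap.smul_apply, coordBil_apply]; rw [mul_comm])
      (fun x y hx hy => by
        simp only [LinearMap.smul_apply, coordBil_apply, hev i hi x hx]; simp)
    refine ⟨f, fun x hx => ?_, fun x y => ?_⟩
    · rw [hf1 x hx]
      simp only [LinearMap.smul_apply, coordBil_apply, smul_eq_mul]
      rw [← mul_assoc, inv_mul_cancel₀ h2, one_mul]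
    · rw [hf2]; simp only [LinearMap.smul_apply, coordBil_apply, smul_eq_mul]
  have hdual2 : ∀ q : {q : idx × idx // q.1 < q.2}, ∃ (f : G →ₗ[F] F) (s : F),
      (∀ x ∈ gr F M 0, f (d.gam x) = 2⁻¹ * (v.coord q.1.1 x * v.coord q.1.2 x
        + s * (v.coord q.1.2 x * v.coord q.1.1 x))) ∧
      (∀ x y, f (d.bil x y) = v.coord q.1.1 x * v.coord q.1.2 y
        + s * (v.coord q.1.2 x * v.coord q.1.1 y)) := by
    rintro ⟨⟨i, j⟩, hij⟩
    have main : ∃ s : F,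
        (∀ x y, x ∈ gr F M 0 → y ∈ gr F M 0 →
          v.coord i x * v.coord j y + s * (v.coord j x * v.coord i y)
            = v.coord i y * v.coord j x + s * (v.coord j y * v.coord i x)) ∧
        (∀ x y, x ∈ gr F M 0 → y ∈ gr F M 1 →
          v.coord i x * v.coord j y + s * (v.coord j x * v.coord i y)
            = v.coord i y * v.coord j x + s * (v.coord j y * v.coord i x)) ∧
        (∀ x y, x ∈ gr F M 1 → y ∈ gr F M 1 →
          v.coord i x * v.coord j y + s * (v.coord j x * v.coord i y)
            = -(v.coord i y * v.coord j x + s * (v.coord j y * v.coord i x))) := by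
      by_cases h : v i ∈ gr F M 1 ∧ v j ∈ gr F M 1
      · refine ⟨-1, fun x y hx hy => ?_, fun x y hx hy => ?_, fun x y hx hy => ?_⟩
        · rw [hod i h.1 x hx, hod j h.2 x hx]; ring
        · rw [hod i h.1 x hx, hod j h.2 x hx]; ring
        · ring
      · refine ⟨1, fun x y hx hy => by ring, fun x y hx hy => by ring, fun x y hx hy => ?_⟩
        have : v i ∈ gr F M 0 ∨ v j ∈ gr F M 0 := by
          rcases hhom i with h1 | h1
          · exact Or.inl h1
          · rcases hhom j with h3 | h3
            · exact Or.inr h3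
            · exact absurd ⟨h1, h3⟩ h
        rcases this with h1 | h1
        · rw [hev i h1 x hx, hev i h1 y hy]; ring
        · rw [hev j h1 x hx, hev j h1 y hy]; ring
    obtain ⟨s, m1, m2, m3⟩ := main
    obtain ⟨f, hf1, hf2⟩ := exists_dual h2 d hG (coordBil v i j + s • coordBil v j i)
      m1 m2 m3
    exact ⟨f, s, hf1, hf2⟩
  choose f1 hf1g hf1b using hdual1
  choose f2 s hf2g hf2b using hdual2
  have hli : LinearIndependent F fam := by
    have cd : ∀ i j, v.coord i (v j) = if j = i then 1 else 0 := by
      intro i j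
      rw [Basis.coord_apply, Basis.repr_self, Finsupp.single_apply]
    refine LinearIndependent.of_pairwise_dual_eq_zero_one fam (Sum.elim f1 f2) ?_ ?_
    · rintro (i | ⟨⟨i, j⟩, hij⟩) (k | ⟨⟨k, l⟩, hkl⟩) hne
      · have : k.1 ≠ i.1 := fun h => hne (by rw [Subtype.ext h])
        simp only [fam, Sum.elim_inl, hf1g i _ k.2, cd, if_neg this, mul_zero]
      · simp only [fam, Sum.elim_inl, Sum.elim_inr, hf1b, cd]
        dsimp only at hkl ⊢
        split_ifs with h1 h3
        · exact absurd (h1.trans h3.symm) hkl.ne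
        all_goals simp
      · simp only [fam, Sum.elim_inl, Sum.elim_inr, hf2g _ _ k.2, cd]
        dsimp only at hij ⊢
        split_ifs with h1 h3
        · exact absurd (h1.symm.trans h3) hij.ne
        all_goals simp
      · simp only [fam, Sum.elim_inr, hf2b, cd]
        dsimp only at hij hkl ⊢
        have e1 : ¬ (k = i ∧ l = j) := by
          rintro ⟨rfl, rfl⟩; exact hne rfl
        have e2 : ¬ (k = j ∧ l = i) := by
          rintro ⟨rfl, rfl⟩; exact lt_asymm hij hkl
        simp only [ite_mul_ite_helper]
        simp [e1, e2]
    · rintro (i | ⟨⟨i, j⟩, hij⟩)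
      · simp only [fam, Sum.elim_inl, hf1g i _ i.2, cd, if_true, mul_one]
      · simp only [fam, Sum.elim_inr, hf2b, cd]
        dsimp only at hij ⊢
        simp [hij.ne]
  refine ⟨Basis.mk hli hspan, fun i => ?_, fun q => ?_⟩
  · rw [Basis.mk_apply]; rfl
  · rw [Basis.mk_apply]; rfl
end

section
/- Let M be a Lie superalgebra over a field of characteristic ≠ 2, 3 such that M^{ab} = M/[M, M] is a free supermodule. Then the homomorphism ψ in the exact sequence Γ(M^{ab}) →ψ M ⊗ M →π M ∧ M → 0 is injective; consequently the sequence 0 → Γ(M^{ab}) →ψ M ⊗ M →π M ∧ M → 0 is exact. -/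
open Module Function TensorProduct

universe u v w x y z

namespace Aux17

section
variable {F : Type u} [Field F]

lemma span_gamma {V : Type v} {W : Type w}
    [AddCommGroup V] [Module F V] [SuperModule F V] [AddCommGroup W] [Module F W]
    (d : GammaData F V W) (hd : IsGamma F V W d) :
    Submodule.span F ({t | ∃ q ∈ gr F V 0, t = d.gam q} ∪ {t | ∃ q q' : V, t = d.bil q q'}) = ⊤ := by
  set S := Submodule.span F
    ({t | ∃ q ∈ gr F V 0, t = d.gam q} ∪ {t | ∃ q q' : V, t = d.bil q q'}) with hS
  let z : GammaData F V (ULift.{max u v w} (W ⧸ S)) :=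
    { gam := fun _ => 0
      bil := 0
      gam_smul := by intros; simp
      gam_add := by intros; simp
      bil_symm := by intros; simp
      bil_alt := by intros; simp }
  obtain ⟨h, _, hu⟩ := hd _ z
  have h1 := hu ((ULift.moduleEquiv.symm : (W ⧸ S) ≃ₗ[F] ULift.{max u v w} (W ⧸ S)).toLinearMap ∘ₗ
    S.mkQ) (by
      constructor
      · intro q hq
        have : S.mkQ (d.gam q) = 0 := by
          rw [Submodule.mkQ_apply, Submodule.Quotient.mk_eq_zero]
          exact Submodule.subset_span (Or.inl ⟨q, hq, rfl⟩)
        rw [LinearMap.comp_apply, this, map_zero]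
      · intro q q'
        have : S.mkQ (d.bil q q') = 0 := by
          rw [Submodule.mkQ_apply, Submodule.Quotient.mk_eq_zero]
          exact Submodule.subset_span (Or.inr ⟨q, q', rfl⟩)
        rw [LinearMap.comp_apply, this, map_zero]; rfl)
  have h2 := hu 0 (by constructor <;> intros <;> rfl)
  have h3 := h1.trans h2.symm
  rw [eq_top_iff]
  intro g _
  have h4 := LinearMap.congr_fun h3 g
  rw [LinearMap.comp_apply, LinearMap.zero_apply] at h4
  have h5 : S.mkQ g = 0 := (LinearEquiv.map_eq_zero_iff _).1 h4
  rwa [Submodule.mkQ_apply, Submodule.Quotient.mk_eq_zero] at h5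

/-- Homogeneous projections. -/
lemma exists_proj (V : Type v) [AddCommGroup V] [Module F V] [SuperModule F V] :
    ∃ P0 P1 : V →ₗ[F] V, (∀ x, P0 x + P1 x = x) ∧ (∀ x, P0 x ∈ gr F V 0) ∧
      (∀ x, P1 x ∈ gr F V 1) ∧ (∀ x ∈ gr F V 0, P0 x = x ∧ P1 x = 0) ∧
      (∀ x ∈ gr F V 1, P0 x = 0 ∧ P1 x = x) := by
  have hc := SuperModule.isCompl_grade (F := F) (V := V)
  have key : ∀ (P : Submodule F V) (R : Submodule F V) (h : IsCompl P R), ∃ f : V →ₗ[F] V,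
      (∀ x, f x ∈ P) ∧ (∀ x, x - f x ∈ R) ∧ (∀ x ∈ P, f x = x) ∧ (∀ x ∈ R, f x = 0) := by
    intro P R h
    have h1 : ∀ x ∈ P, (P.subtype ∘ₗ P.projectionOnto R h) x = x := fun x hx => by
      exact congrArg Subtype.val (Submodule.projectionOnto_apply_left h ⟨x, hx⟩)
    have h2 : ∀ x ∈ R, (P.subtype ∘ₗ P.projectionOnto R h) x = 0 := fun x hx => by
      rw [LinearMap.comp_apply, (Submodule.projectionOnto_apply_eq_zero_iff h).2 hx, map_zero]
    refine ⟨P.subtype ∘ₗ P.projectionOnto R h, fun x => by simp, fun x => ?_, h1, h2⟩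
    obtain ⟨a, ha, b, hb, rfl⟩ := Submodule.mem_sup.1
      (show x ∈ P ⊔ R by rw [h.sup_eq_top]; trivial)
    rw [map_add, h1 a ha, h2 b hb]
    simpa using hb
  obtain ⟨f, f1, f2, f3, f4⟩ := key _ _ hc
  refine ⟨f, LinearMap.id - f, fun x => by simp, f1, fun x => by simpa using f2 x,
    fun x hx => ?_, fun x hx => ?_⟩
  · simp [f3 x hx]
  · simp [f4 x hx]

lemma exists_ret (M : Type v) [AddCommGroup M] [Module F M] [SuperModule F M]
    [LieSuperAlgebra F M]
    (T : Type w) [AddCommGroup T] [Module F T] [SuperModule F T] [LieSuperAlgebra F T]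
    (p : TensorSqPairing F M T) (hT : IsTensorSquare F M T p) :
    ∃ h : T →ₗ[F] ((M ⧸ derivedSub F M) ⊗[F] (M ⧸ derivedSub F M)),
      ∀ x y, h (p.pair x y) = (derivedSub F M).mkQ x ⊗ₜ (derivedSub F M).mkQ y := by
  obtain ⟨P0, P1, hP, hP0, hP1, h0, h1⟩ := exists_proj (F := F) M
  set k := (derivedSub F M).mkQ with hk
  have hbr : ∀ x y, k (br F M x y) = 0 := fun x y => by
    rw [hk, Submodule.mkQ_apply, Submodule.Quotient.mk_eq_zero]
    exact Submodule.subset_span ⟨x, y, rfl⟩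
  have aux : ∀ a b : ZMod 2, ∀ x ∈ gr F M a, ∀ y ∈ gr F M b,
      k (P0 (br F M x y)) = 0 ∧ k (P1 (br F M x y)) = 0 := by
    intro a b x hx y hy
    have hg := LieSuperAlgebra.bracket_grade a b x y hx hy
    have hab : a + b = 0 ∨ a + b = 1 := by
      clear hg hx hy; revert a b; decide
    rcases hab with hab | hab <;> rw [hab] at hg
    · rw [(h0 _ hg).1, (h0 _ hg).2]; simp [hbr]
    · rw [(h1 _ hg).1, (h1 _ hg).2]; simp [hbr]
  have kill : ∀ x y, k (P0 (br F M x y)) = 0 ∧ k (P1 (br F M x y)) = 0 := by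
    intro x y
    rw [← hP x, ← hP y]
    simp only [map_add, LinearMap.add_apply]
    constructor
    · simp [(aux _ _ _ (hP0 x) _ (hP0 y)).1, (aux _ _ _ (hP0 x) _ (hP1 y)).1,
        (aux _ _ _ (hP1 x) _ (hP0 y)).1, (aux _ _ _ (hP1 x) _ (hP1 y)).1]
    · simp [(aux _ _ _ (hP0 x) _ (hP0 y)).2, (aux _ _ _ (hP0 x) _ (hP1 y)).2,
        (aux _ _ _ (hP1 x) _ (hP0 y)).2, (aux _ _ _ (hP1 x) _ (hP1 y)).2]
  let E := (M ⧸ derivedSub F M) ⊗[F] (M ⧸ derivedSub F M)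
  let U := ULift.{max u w} (E × E)
  let e : U ≃ₗ[F] E × E := ULift.moduleEquiv
  let sU : SuperModule F U :=
    { grade := fun a => if a = 0 then LinearMap.ker (LinearMap.snd F E E ∘ₗ e.toLinearMap)
        else LinearMap.ker (LinearMap.fst F E E ∘ₗ e.toLinearMap)
      isCompl_grade := by
        simp only [if_true, if_neg (one_ne_zero : (1 : ZMod 2) ≠ 0)]
        constructor
        · rw [Submodule.disjoint_def]
          intro x hx hy
          apply e.injective
          rw [map_zero]
          exact Prod.ext hy hx
        · rw [codisjoint_iff, eq_top_iff]
          intro x _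
          refine Submodule.mem_sup.2 ⟨e.symm ((e x).1, 0), ?_, e.symm (0, (e x).2), ?_, ?_⟩
          · simp
          · simp
          · rw [← map_add]; simp }
  let lU : LieSuperAlgebra F U :=
    { bracket := 0
      bracket_grade := by intros; exact Submodule.zero_mem _
      skew := by intros; simp
      jacobi := by intros; simp }
  let b : (M →ₗ[F] M) → (M →ₗ[F] M) → (M →ₗ[F] M →ₗ[F] E) := fun A B =>
    (TensorProduct.mk F _ _).compl₁₂ (k ∘ₗ A) (k ∘ₗ B)
  have hb : ∀ A B x y, b A B x y = k (A x) ⊗ₜ k (B y) := fun A B x y => rfl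
  let c : M →ₗ[F] M →ₗ[F] U :=
    (b P0 P0 + b P1 P1).compr₂ (e.symm.toLinearMap ∘ₗ LinearMap.inl F E E) +
    (b P0 P1 + b P1 P0).compr₂ (e.symm.toLinearMap ∘ₗ LinearMap.inr F E E)
  have hc : ∀ x y, e (c x y) = (k (P0 x) ⊗ₜ k (P0 y) + k (P1 x) ⊗ₜ k (P1 y),
      k (P0 x) ⊗ₜ k (P1 y) + k (P1 x) ⊗ₜ k (P0 y)) := by
    intro x y
    simp [c, hb]
  have c1 : ∀ x x' y, c (br F M x x') y = 0 := fun x x' y => by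
    apply e.injective
    rw [hc, (kill x x').1, (kill x x').2]; simp
  have c2 : ∀ x y y', c x (br F M y y') = 0 := fun x y y' => by
    apply e.injective
    rw [hc, (kill y y').1, (kill y y').2]; simp
  let q : TensorSqPairing F M U :=
    { pair := c
      pair_grade := by
        intro a b x y hx hy
        have ha : a = 0 ∨ a = 1 := by clear hx; revert a; decide
        have hb : b = 0 ∨ b = 1 := by clear hy; revert b; decide
        have key0 : (e (c x y)).2 = 0 → c x y ∈ gr F U 0 := fun h => h
        have key1 : (e (c x y)).1 = 0 → c x y ∈ gr F U 1 := fun h => h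
        rcases ha with rfl | rfl <;> rcases hb with rfl | rfl
        · apply key0; rw [hc, (h0 x hx).2, (h0 y hy).2]; simp
        · apply key1; rw [hc, (h0 x hx).2, (h1 y hy).1]; simp
        · apply key1; rw [hc, (h1 x hx).1, (h0 y hy).2]; simp
        · apply key0; rw [hc, (h1 x hx).1, (h1 y hy).1]; simp
      rel1 := by intros; simp [c1, c2]
      rel2 := by intros; simp [c1, c2]
      rel3 := by
        intros
        rw [c1, smul_zero]; rfl }
  obtain ⟨h, hh, _⟩ := hT U q
  refine ⟨(LinearMap.fst F E E + LinearMap.snd F E E) ∘ₗ e.toLinearMap ∘ₗ h.toLinearMap, ?_⟩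
  intro x y
  have : e (h.toLinearMap (p.pair x y)) = e (c x y) := by rw [hh x y]
  simp only [LinearMap.comp_apply, LinearEquiv.coe_coe, LinearMap.add_apply]
  rw [this, hc]
  conv_rhs => rw [← hP x, ← hP y]
  simp only [LinearMap.fst_apply, LinearMap.snd_apply, map_add, TensorProduct.add_tmul,
    TensorProduct.tmul_add]
  abel

end

end Aux17

theorem stmt_17 (F : Type*) [Field F] (hchar2 : ringChar F ≠ 2) (hchar3 : ringChar F ≠ 3)
    (M : Type*) [AddCommGroup M] [Module F M] [SuperModule F M] [LieSuperAlgebra F M]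
    (T : Type*) [AddCommGroup T] [Module F T] [SuperModule F T] [LieSuperAlgebra F T]
    (p : TensorSqPairing F M T) (hT : IsTensorSquare F M T p)
    (Q : Type*) [AddCommGroup Q] [Module F Q] [SuperModule F Q] [LieSuperAlgebra F Q]
    (π : LieSuperHom F M Q) (hπs : Function.Surjective π.toLinearMap)
    (hπk : LinearMap.ker π.toLinearMap = derivedSub F M)
    (hfree : Module.Free F Q)
    (G : Type*) [AddCommGroup G] [Module F G]
    (d : GammaData F Q G) (hG : IsGamma F Q G d)
    (ψ : G →ₗ[F] T)
    (hψ1 : ∀ x : M, x ∈ gr F M 0 → ψ (d.gam (π.toLinearMap x)) = p.pair x x)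
    (hψ2 : ∀ (a b : ZMod 2) (x y : M), x ∈ gr F M a → y ∈ gr F M b →
      ψ (d.bil (π.toLinearMap x) (π.toLinearMap y))
        = p.pair x y + sgn F a b • p.pair y x) :
    Function.Injective ψ ∧ LinearMap.range ψ = squareBox F M T p ∧
      Function.Surjective (squareBox F M T p).mkQ := by
  have two : (2 : F) ≠ 0 := Ring.two_ne_zero hchar2
  have hspan := Aux17.span_gamma d hG
  obtain ⟨h, hh⟩ := Aux17.exists_ret M T p hT
  obtain ⟨P0, P1, hP, hP0, hP1, -, -⟩ := Aux17.exists_proj (F := F) M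
  obtain ⟨R0, R1, -, -, -, r0, r1⟩ := Aux17.exists_proj (F := F) Q
  have lift0 : ∀ q ∈ gr F Q 0, ∃ x ∈ gr F M 0, π.toLinearMap x = q := by
    intro q hq
    obtain ⟨x, rfl⟩ := hπs q
    refine ⟨P0 x, hP0 x, ?_⟩
    have e1 := (r0 _ hq).1
    have e2 : π.toLinearMap x = π.toLinearMap (P0 x) + π.toLinearMap (P1 x) := by
      rw [← map_add, hP]
    rw [e2, map_add, (r0 _ (π.map_grade _ _ (hP0 x))).1,
      (r1 _ (π.map_grade _ _ (hP1 x))).1, add_zero, ← e2] at e1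
    exact e1
  have gam2 : ∀ q ∈ gr F Q 0, d.bil q q = (2 : F) • d.gam q := by
    intro q hq
    have h1 := d.gam_add q q hq hq
    have h2 := d.gam_smul 2 q hq
    rw [two_smul] at h2
    rw [← h1, h2]
    module
  have bil_ind : ∀ (C : Submodule F G), (∀ (a b : ZMod 2) (x y : M), x ∈ gr F M a → y ∈ gr F M b →
      d.bil (π.toLinearMap x) (π.toLinearMap y) ∈ C) → ∀ q q' : Q, d.bil q q' ∈ C := by
    intro C hC q q'
    obtain ⟨x, rfl⟩ := hπs q
    obtain ⟨y, rfl⟩ := hπs q'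
    rw [← hP x, ← hP y]
    simp only [map_add, LinearMap.add_apply]
    exact C.add_mem
      (C.add_mem (hC _ _ _ _ (hP0 x) (hP0 y)) (hC _ _ _ _ (hP1 x) (hP0 y)))
      (C.add_mem (hC _ _ _ _ (hP0 x) (hP1 y)) (hC _ _ _ _ (hP1 x) (hP1 y)))
  have ind : ∀ (C : Submodule F G), (∀ x ∈ gr F M 0, d.gam (π.toLinearMap x) ∈ C) →
      (∀ (a b : ZMod 2) (x y : M), x ∈ gr F M a → y ∈ gr F M b →
      d.bil (π.toLinearMap x) (π.toLinearMap y) ∈ C) → C = ⊤ := by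
    intro C hC1 hC2
    rw [eq_top_iff, ← hspan, Submodule.span_le]
    rintro t (⟨q, hq, rfl⟩ | ⟨q, q', rfl⟩)
    · obtain ⟨x, hx, rfl⟩ := lift0 q hq
      exact hC1 x hx
    · exact bil_ind C hC2 q q'
  let j : (M ⧸ derivedSub F M) →ₗ[F] Q := (derivedSub F M).liftQ π.toLinearMap hπk.ge
  have hj : ∀ x, j ((derivedSub F M).mkQ x) = π.toLinearMap x := fun x => by
    simp [j]
  let s : T →ₗ[F] G := (2⁻¹ : F) • (TensorProduct.lift (d.bil.compl₁₂ j j) ∘ₗ h)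
  have hs : ∀ x y, s (p.pair x y) = (2⁻¹ : F) • d.bil (π.toLinearMap x) (π.toLinearMap y) := by
    intro x y
    simp only [s, LinearMap.smul_apply, LinearMap.comp_apply, hh, TensorProduct.lift.tmul,
      LinearMap.compl₁₂_apply, hj]
  have hret : LinearMap.eqLocus (s ∘ₗ ψ) LinearMap.id = ⊤ := by
    apply ind
    · intro x hx
      rw [LinearMap.mem_eqLocus, LinearMap.comp_apply, hψ1 x hx, hs,
        gam2 _ (π.map_grade _ _ hx), smul_smul, inv_mul_cancel₀ two, one_smul]
      rfl
    · intro a b x y hx hy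
      rw [LinearMap.mem_eqLocus, LinearMap.comp_apply, hψ2 a b x y hx hy, map_add, map_smul, hs, hs,
        smul_comm, ← d.bil_symm a b _ _ (π.map_grade _ _ hx) (π.map_grade _ _ hy), ← add_smul,
        show (2⁻¹ + 2⁻¹ : F) = 1 by field_simp; norm_num, one_smul]
      rfl
  refine ⟨?_, ?_, Submodule.mkQ_surjective _⟩
  · apply Function.LeftInverse.injective (g := s)
    intro g
    have : g ∈ LinearMap.eqLocus (s ∘ₗ ψ) LinearMap.id := by rw [hret]; trivial
    exact this
  · apply le_antisymm
    · rw [LinearMap.range_eq_map, Submodule.map_le_iff_le_comap, top_le_iff]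
      apply ind
      · intro x hx
        rw [Submodule.mem_comap, hψ1 x hx]
        exact Submodule.subset_span (Or.inr ⟨x, hx, rfl⟩)
      · intro a b x y hx hy
        rw [Submodule.mem_comap, hψ2 a b x y hx hy]
        exact Submodule.subset_span (Or.inl ⟨a, b, x, y, hx, hy, rfl⟩)
    · rw [squareBox, Submodule.span_le]
      rintro t (⟨a, b, x, y, hx, hy, rfl⟩ | ⟨x, hx, rfl⟩)
      · exact ⟨_, hψ2 a b x y hx hy⟩
      · exact ⟨_, hψ1 x hx⟩
end
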